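/- Let β ≥ 4·log n, let G=[n]² be the n×n grid, and let A={(i,i) : i∈[n]} be the diagonal, pinned to −1. Starting from the configuration that is +1 on V∖A, the A-corrupted Glauber dynamics reaches the identically −1 configuration in expected time O(n⁵): there is a universal constant C such that E[inf{t : X̃_t ≡ −1}] ≤ C·n⁵. -/

import Mathlib

open Real Finset
open scoped Classical

noncomputable section

/-- The `n × n` grid graph on `[n]² = Fin n × Fin n`. -/
def grid (n : ℕ) : SimpleGraph (Fin n × Fin n) :=
  SimpleGraph.fromRel (fun p q =>
    (p.1 = q.1 ∧ p.2.val + 1 = q.2.val) ∨ (p.2 = q.2 ∧ p.1.val + 1 = q.1.val))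

variable {V : Type*} [Fintype V] [DecidableEq V]

/-- The real value of a spin: `true ↦ +1`, `false ↦ -1`. -/
def spinVal (b : Bool) : ℝ := if b then 1 else -1

/-- Sum of the spins of the neighbors of `v`. -/
def nbrSum (G : SimpleGraph V) (σ : V → Bool) (v : V) : ℝ :=
  ∑ u : V, if G.Adj v u then spinVal (σ u) else 0

/-- Glauber probability of updating `v` to `+1`. -/
def glauberP (β : ℝ) (G : SimpleGraph V) (σ : V → Bool) (v : V) : ℝ :=
  exp (β * nbrSum G σ v) / (exp (β * nbrSum G σ v) + exp (-(β * nbrSum G σ v)))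

/-- One-step kernel of the `A`-corrupted Glauber dynamics with `A` pinned to spin `s`. -/
def pinnedK (G : SimpleGraph V) (β : ℝ) (A : Finset V) (s : Bool)
    (σ σ' : V → Bool) : ℝ :=
  (Fintype.card V : ℝ)⁻¹ * ∑ v : V,
    if v ∈ A then (if σ' = Function.update σ v s then 1 else 0)
    else (if σ' = Function.update σ v true then glauberP β G σ v else 0)
       + (if σ' = Function.update σ v false then 1 - glauberP β G σ v else 0)

/-- Probability of a trajectory `h` of length `t+1` of the Markov chain with kernel `K`
started at `σ₀`. -/
def trajMC (σ₀ : V → Bool) (K : (V → Bool) → (V → Bool) → ℝ) :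
    (t : ℕ) → (Fin (t+1) → (V → Bool)) → ℝ
  | 0, h => if h 0 = σ₀ then 1 else 0
  | t+1, h => trajMC σ₀ K t (fun i => h i.castSucc) *
      K (h (Fin.last t).castSucc) (h (Fin.last (t+1)))

/-- Probability that the chain has not visited the configuration `bad` by time `t`. -/
def survProb (σ₀ : V → Bool) (K : (V → Bool) → (V → Bool) → ℝ)
    (bad : V → Bool) (t : ℕ) : ℝ :=
  ∑ h : Fin (t+1) → (V → Bool),
    if (∀ i, h i ≠ bad) then trajMC σ₀ K t h else 0

/-- Expected hitting time of the configuration `bad`: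
`E[τ] = ∑_{t ≥ 0} P(τ > t)`. -/
def expHitTime (σ₀ : V → Bool) (K : (V → Bool) → (V → Bool) → ℝ)
    (bad : V → Bool) : ℝ :=
  ∑' t : ℕ, survProb σ₀ K bad t

/-- The diagonal `{(i,i) : i ∈ [n]}` of the grid. -/
def diag (n : ℕ) : Finset (Fin n × Fin n) := univ.filter (fun p => p.1 = p.2)

section Lyapunov

variable {W : Type*} [Fintype W] [DecidableEq W]

lemma traj_nonneg (σ₀ : W → Bool) (K : (W → Bool) → (W → Bool) → ℝ)
    (hK : ∀ x y, 0 ≤ K x y) (t : ℕ) (h : Fin (t+1) → (W → Bool)) :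
    0 ≤ trajMC σ₀ K t h := by
  induction t with
  | zero => unfold trajMC; split_ifs <;> norm_num
  | succ t ih => unfold trajMC; exact mul_nonneg (ih _) (hK _ _)

def lyapPhi (σ₀ : W → Bool) (K : (W → Bool) → (W → Bool) → ℝ)
    (bad : W → Bool) (f : (W → Bool) → ℝ) (t : ℕ) : ℝ :=
  ∑ h : Fin (t+1) → (W → Bool),
    if (∀ i, h i ≠ bad) then trajMC σ₀ K t h * f (h (Fin.last t)) else 0

lemma lyapPhi_succ (σ₀ : W → Bool) (K : (W → Bool) → (W → Bool) → ℝ)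
    (hK : ∀ x y, 0 ≤ K x y) (bad : W → Bool) (f : (W → Bool) → ℝ) (hf : ∀ x, 0 ≤ f x)
    (ε : ℝ) (hd : ∀ x, x ≠ bad → ∑ y, K x y * f y ≤ f x - ε) (t : ℕ) :
    lyapPhi σ₀ K bad f (t+1) ≤ lyapPhi σ₀ K bad f t - ε * survProb σ₀ K bad t := by
  unfold lyapPhi survProb
  rw [← (Fin.snocEquiv (fun _ : Fin (t+1+1) => (W → Bool))).sum_comp, Fintype.sum_prod_type_right,
    Finset.mul_sum, ← Finset.sum_sub_distrib]
  apply Finset.sum_le_sum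
  intro h _
  by_cases hb : ∀ i, h i ≠ bad
  · rw [if_pos hb, if_pos hb]
    have h1 : ∀ y : W → Bool,
        (if (∀ i, (Fin.snocEquiv (fun _ : Fin (t+1+1) => (W → Bool))) (y, h) i ≠ bad) then
          trajMC σ₀ K (t+1) ((Fin.snocEquiv (fun _ : Fin (t+1+1) => (W → Bool))) (y, h)) *
          f ((Fin.snocEquiv (fun _ : Fin (t+1+1) => (W → Bool))) (y, h) (Fin.last (t+1))) else 0)
        ≤ trajMC σ₀ K t h * (K (h (Fin.last t)) y * f y) := by
      intro y
      have e : trajMC σ₀ K (t+1) ((Fin.snocEquiv (fun _ : Fin (t+1+1) => (W → Bool))) (y, h)) *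
          f ((Fin.snocEquiv (fun _ : Fin (t+1+1) => (W → Bool))) (y, h) (Fin.last (t+1)))
          = trajMC σ₀ K t h * (K (h (Fin.last t)) y * f y) := by
        simp only [trajMC, Fin.snocEquiv_apply, Fin.snoc_castSucc, Fin.snoc_last, mul_assoc]
      split_ifs
      · exact e.le
      · exact mul_nonneg (traj_nonneg _ _ hK _ _) (mul_nonneg (hK _ _) (hf _))
    refine (Finset.sum_le_sum (fun y _ => h1 y)).trans ?_
    rw [← Finset.mul_sum]
    have := mul_le_mul_of_nonneg_left (hd _ (hb (Fin.last t))) (traj_nonneg σ₀ K hK t h)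
    linarith
  · rw [if_neg hb, if_neg hb]
    apply le_of_eq
    rw [mul_zero, sub_zero]
    apply Finset.sum_eq_zero
    intro y _
    rw [if_neg]
    intro hc
    apply hb
    intro i
    have := hc i.castSucc
    simpa [Fin.snocEquiv_apply] using this

lemma expHit_le (σ₀ : W → Bool) (K : (W → Bool) → (W → Bool) → ℝ)
    (hK : ∀ x y, 0 ≤ K x y) (bad : W → Bool) (f : (W → Bool) → ℝ) (hf : ∀ x, 0 ≤ f x)
    (ε : ℝ) (hε : 0 < ε) (hd : ∀ x, x ≠ bad → ∑ y, K x y * f y ≤ f x - ε) :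
    expHitTime σ₀ K bad ≤ f σ₀ / ε := by
  unfold expHitTime
  have hPhi : ∀ t, 0 ≤ lyapPhi σ₀ K bad f t := by
    intro t
    apply Finset.sum_nonneg
    intro h _
    split_ifs
    · exact mul_nonneg (traj_nonneg _ _ hK _ _) (hf _)
    · exact le_rfl
  have h0 : lyapPhi σ₀ K bad f 0 ≤ f σ₀ := by
    unfold lyapPhi
    rw [Finset.sum_eq_single (fun _ => σ₀)]
    · split_ifs
      · simp [trajMC]
      · exact hf _
    · intro h _ hne
      have : h 0 ≠ σ₀ := by
        intro hh
        apply hne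
        funext i
        rw [show i = 0 from Fin.ext (by omega), hh]
      simp [trajMC, this]
    · simp
  have key : ∀ T, lyapPhi σ₀ K bad f T + ε * ∑ t ∈ Finset.range T, survProb σ₀ K bad t ≤ f σ₀ := by
    intro T
    induction T with
    | zero => simpa using h0
    | succ T ih =>
      rw [Finset.sum_range_succ]
      have := lyapPhi_succ σ₀ K hK bad f hf ε hd T
      linarith
  apply Real.tsum_le_of_sum_range_le
  · intro t
    apply Finset.sum_nonneg
    intro h _
    split_ifs
    · exact traj_nonneg _ _ hK _ _
    · exact le_rfl
  · intro T
    rw [le_div_iff₀ hε]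
    have := key T
    have := hPhi T
    linarith

end Lyapunov

lemma glauberP_nonneg (β : ℝ) (G : SimpleGraph V) (σ : V → Bool) (v : V) :
    0 ≤ glauberP β G σ v := by unfold glauberP; positivity

lemma glauberP_le_one (β : ℝ) (G : SimpleGraph V) (σ : V → Bool) (v : V) :
    glauberP β G σ v ≤ 1 := by
  unfold glauberP
  rw [div_le_one (by positivity)]
  have := exp_pos (-(β * nbrSum G σ v))
  linarith

lemma glauberP_le_half (β : ℝ) (hβ : 0 ≤ β) (G : SimpleGraph V) (σ : V → Bool) (v : V)
    (h : nbrSum G σ v ≤ 0) : glauberP β G σ v ≤ 1/2 := by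
  unfold glauberP
  rw [div_le_iff₀ (by positivity)]
  have : exp (β * nbrSum G σ v) ≤ exp (-(β * nbrSum G σ v)) := by
    apply exp_le_exp.2
    nlinarith [mul_nonneg hβ (neg_nonneg.2 h)]
  linarith

lemma glauberP_le_small (β : ℝ) (n : ℕ) (hn : 2 ≤ n) (hβ : 4 * Real.log n ≤ β)
    (G : SimpleGraph V) (σ : V → Bool) (v : V)
    (h : nbrSum G σ v ≤ -1) : glauberP β G σ v ≤ 1 / (n:ℝ)^8 := by
  have hn0 : (0:ℝ) < n := by positivity
  have hlog : 0 ≤ Real.log n := Real.log_natCast_nonneg n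
  unfold glauberP
  have h1 : exp (β * nbrSum G σ v) * (n:ℝ)^8 ≤ exp (-(β * nbrSum G σ v)) := by
    have : (n:ℝ)^8 = exp (8 * Real.log n) := by
      rw [show (8:ℝ) * Real.log n = ((8:ℕ):ℝ) * Real.log n by norm_num, Real.exp_nat_mul,
        Real.exp_log hn0]
    rw [this, ← Real.exp_add]
    apply exp_le_exp.2
    nlinarith [mul_nonneg (by linarith : 0 ≤ β) (by linarith : 0 ≤ -1 - nbrSum G σ v)]
  rw [div_le_div_iff₀ (by positivity) (by positivity)]
  have := exp_pos (β * nbrSum G σ v)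
  linarith

lemma pinnedK_nonneg (G : SimpleGraph V) (β : ℝ) (A : Finset V) (s : Bool)
    (σ σ' : V → Bool) : 0 ≤ pinnedK G β A s σ σ' := by
  unfold pinnedK
  apply mul_nonneg (by positivity)
  apply Finset.sum_nonneg
  intro v _
  have h0 := glauberP_nonneg β G σ v
  have h1 := glauberP_le_one β G σ v
  split_ifs <;> linarith

def stepE (G : SimpleGraph V) (β : ℝ) (A : Finset V) (σ : V → Bool)
    (f : (V → Bool) → ℝ) (v : V) : ℝ :=
  if v ∈ A then f (Function.update σ v false)
    else glauberP β G σ v * f (Function.update σ v true)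
      + (1 - glauberP β G σ v) * f (Function.update σ v false)

lemma pinnedK_sum (G : SimpleGraph V) (β : ℝ) (A : Finset V)
    (σ : V → Bool) (f : (V → Bool) → ℝ) :
    ∑ y, pinnedK G β A false σ y * f y =
      (Fintype.card V : ℝ)⁻¹ * ∑ v : V, stepE G β A σ f v := by
  unfold pinnedK stepE
  simp_rw [mul_assoc, ← Finset.mul_sum, Finset.sum_mul]
  rw [Finset.sum_comm]
  congr 1
  apply Finset.sum_congr rfl
  intro v _
  split_ifs
  · simp
  · simp [add_mul, Finset.sum_add_distrib]

section Upper

variable {n : ℕ}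

def Yu (σ : Fin n × Fin n → Bool) : Finset (Fin n × Fin n) :=
  univ.filter (fun v => ∃ w : Fin n × Fin n, σ w = true ∧ w.1 < w.2 ∧ v.1 ≤ w.1 ∧ w.2 ≤ v.2)

lemma mem_Yu {σ : Fin n × Fin n → Bool} {v : Fin n × Fin n} : v ∈ Yu σ ↔
    ∃ w : Fin n × Fin n, σ w = true ∧ w.1 < w.2 ∧ v.1 ≤ w.1 ∧ w.2 ≤ v.2 := by
  simp [Yu]

lemma Yu_up {σ : Fin n × Fin n → Bool} {v w : Fin n × Fin n} (hv : v ∈ Yu σ)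
    (h1 : w.1 ≤ v.1) (h2 : v.2 ≤ w.2) : w ∈ Yu σ := by
  rw [mem_Yu] at *
  obtain ⟨x, a, b, c, d⟩ := hv
  exact ⟨x, a, b, h1.trans c, d.trans h2⟩

lemma Yu_lt {σ : Fin n × Fin n → Bool} {v : Fin n × Fin n} (hv : v ∈ Yu σ) : v.1 < v.2 := by
  rw [mem_Yu] at hv
  obtain ⟨x, a, b, c, d⟩ := hv
  exact c.trans_lt (b.trans_le d)

lemma Yu_self {σ : Fin n × Fin n → Bool} {v : Fin n × Fin n} (hv : σ v = true)
    (h : v.1 < v.2) : v ∈ Yu σ := mem_Yu.2 ⟨v, hv, h, le_rfl, le_rfl⟩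

/-- addable sites -/
def AddS (Y : Finset (Fin n × Fin n)) : Finset (Fin n × Fin n) :=
  univ.filter (fun v => v ∉ Y ∧ (∃ u ∈ Y, u.1.val + 1 = v.1.val ∧ u.2 = v.2) ∧
    (∃ u ∈ Y, u.1 = v.1 ∧ v.2.val + 1 = u.2.val ∧ v.1.val < v.2.val))

/-- removable sites -/
def RemS (Y : Finset (Fin n × Fin n)) : Finset (Fin n × Fin n) :=
  univ.filter (fun v => v ∈ Y ∧ (∀ u ∈ Y, ¬ (v.1.val + 1 = u.1.val ∧ u.2 = v.2)) ∧
    (∀ u ∈ Y, ¬ (u.1 = v.1 ∧ u.2.val + 1 = v.2.val)))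

lemma row_min (Y : Finset (Fin n × Fin n)) (w : Fin n × Fin n) (hw : w ∈ Y) :
    ∃ v ∈ Y, v.1 = w.1 ∧ ∀ u ∈ Y, u.1 = w.1 → v.2 ≤ u.2 := by
  obtain ⟨v, hv, hm⟩ := Finset.exists_min_image (Y.filter (fun u => u.1 = w.1)) (fun u => u.2)
    ⟨w, by simp [hw]⟩
  rw [Finset.mem_filter] at hv
  exact ⟨v, hv.1, hv.2, fun u hu h => hm u (by simp [hu, h])⟩

lemma add_card_lt (σ : Fin n × Fin n → Bool) (hne : (Yu σ).Nonempty) :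
    (AddS (Yu σ)).card + 1 ≤ (RemS (Yu σ)).card := by
  obtain ⟨m, hm, hmax⟩ := Finset.exists_max_image (Yu σ) (fun u => u.1) hne
  have hinj : Set.InjOn (fun v : Fin n × Fin n => v.1.val) (AddS (Yu σ) : Set (Fin n × Fin n)) := by
    have aux : ∀ a ∈ AddS (Yu σ), ∀ b ∈ AddS (Yu σ), a.1.val = b.1.val → ¬ a.2 < b.2 := by
      intro a ha b hb hab hlt
      simp only [AddS, Finset.mem_filter] at ha hb
      obtain ⟨_, _, _, u, hu, hu1, hu2⟩ := ha
      apply hb.2.1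
      refine Yu_up hu ?_ ?_
      · rw [hu1]; exact (Fin.ext hab).ge
      · rw [Fin.le_def]; rw [Fin.lt_def] at hlt; omega
    intro a ha b hb hab
    have h1 := aux a ha b hb hab
    have h2 := aux b hb a ha hab.symm
    exact Prod.ext (Fin.ext hab) (le_antisymm (not_lt.1 h2) (not_lt.1 h1))
  have hnot : m.1.val + 1 ∉ (AddS (Yu σ)).image (fun v => v.1.val) := by
    intro h
    rw [Finset.mem_image] at h
    obtain ⟨v, hv, hv1⟩ := h
    simp only [AddS, Finset.mem_filter] at hv
    obtain ⟨_, _, _, u, hu, hu1, hu2⟩ := hv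
    have := hmax u hu
    rw [hu1, Fin.le_def] at this
    omega
  rw [← Finset.card_image_of_injOn hinj, ← Finset.card_insert_of_notMem hnot]
  refine le_trans (Finset.card_le_card ?_)
    (Finset.card_image_le (s := RemS (Yu σ)) (f := fun v => v.1.val + 1))
  intro k hk
  rw [Finset.mem_image]
  rw [Finset.mem_insert, Finset.mem_image] at hk
  rcases hk with rfl | ⟨v, hv, rfl⟩
  · obtain ⟨v, hv, hv1, hvm⟩ := row_min _ m hm
    refine ⟨v, ?_, by rw [hv1]⟩
    simp only [RemS, Finset.mem_filter]
    refine ⟨Finset.mem_univ _, hv, ?_, ?_⟩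
    · rintro u hu ⟨h1, h2⟩
      have := hmax u hu
      rw [← hv1, Fin.le_def] at this
      omega
    · rintro u hu ⟨h1, h2⟩
      have := hvm u hu (h1.trans hv1)
      rw [Fin.le_def] at this
      omega
  · simp only [AddS, Finset.mem_filter] at hv
    obtain ⟨_, hvY, ⟨x, hx, hx1, hx2⟩, u, hu, hu1, hu2⟩ := hv
    obtain ⟨w, hw, hw1, hwm⟩ := row_min _ x hx
    refine ⟨w, ?_, by rw [hw1]; exact hx1⟩
    simp only [RemS, Finset.mem_filter]
    refine ⟨Finset.mem_univ _, hw, ?_, ?_⟩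
    · rintro y hy ⟨h1, h2⟩
      apply hvY
      refine Yu_up hy ?_ ?_
      · rw [Fin.le_def]; rw [hw1] at h1; omega
      · rw [h2, ← hx2]; exact hwm x hx rfl
    · rintro y hy ⟨h1, h2⟩
      have := hwm y hy (h1.trans hw1)
      rw [Fin.le_def] at this
      omega

lemma add_card_le (σ : Fin n × Fin n → Bool) :
    (AddS (Yu σ)).card ≤ (RemS (Yu σ)).card := by
  by_cases h : (Yu σ).Nonempty
  · have := add_card_lt σ h; omega
  · rw [Finset.not_nonempty_iff_eq_empty] at h
    simp [h, AddS]

lemma grid_adj (v u : Fin n × Fin n) : (grid n).Adj v u ↔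
    (v.1 = u.1 ∧ v.2.val + 1 = u.2.val) ∨ (v.2 = u.2 ∧ v.1.val + 1 = u.1.val) ∨
    (v.1 = u.1 ∧ u.2.val + 1 = v.2.val) ∨ (v.2 = u.2 ∧ u.1.val + 1 = v.1.val) := by
  unfold grid
  rw [SimpleGraph.fromRel_adj]
  constructor
  · rintro ⟨_, (h | h) | (h | h)⟩
    · exact Or.inl h
    · exact Or.inr (Or.inl h)
    · exact Or.inr (Or.inr (Or.inl ⟨h.1.symm, h.2⟩))
    · exact Or.inr (Or.inr (Or.inr ⟨h.1.symm, h.2⟩))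
  · intro h
    refine ⟨?_, ?_⟩
    · rintro rfl; omega
    · rcases h with h | h | h | h
      · exact Or.inl (Or.inl h)
      · exact Or.inl (Or.inr h)
      · exact Or.inr (Or.inl ⟨h.1.symm, h.2⟩)
      · exact Or.inr (Or.inr ⟨h.1.symm, h.2⟩)

/-- sum bound -/
lemma nbr_bound (σ : Fin n × Fin n → Bool) (v d l : Fin n × Fin n)
    (hd : d.1.val = v.1.val + 1 ∧ d.2 = v.2) (hl : l.1 = v.1 ∧ l.2.val + 1 = v.2.val)
    (hσd : σ d = false) (hσl : σ l = false) :
    nbrSum (grid n) σ v ≤ -2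
      + ((univ.filter (fun u : Fin n × Fin n =>
          u.1.val + 1 = v.1.val ∧ u.2 = v.2 ∧ σ u = true)).card : ℝ)
      + ((univ.filter (fun u : Fin n × Fin n =>
          u.1 = v.1 ∧ v.2.val + 1 = u.2.val ∧ σ u = true)).card : ℝ) := by
  have hp : ∀ u : Fin n × Fin n, (if (grid n).Adj v u then spinVal (σ u) else 0) ≤
      (if u = d then (-1:ℝ) else 0) + (if u = l then (-1:ℝ) else 0)
      + (if u.1.val + 1 = v.1.val ∧ u.2 = v.2 ∧ σ u = true then (1:ℝ) else 0)
      + (if u.1 = v.1 ∧ v.2.val + 1 = u.2.val ∧ σ u = true then (1:ℝ) else 0) := by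
    intro u
    by_cases hud : u = d
    · subst hud
      have hne : u ≠ l := by rintro rfl; have := hl.1; have := hd.1; simp_all
      have hadj : (grid n).Adj v u := by
        rw [grid_adj]; exact Or.inr (Or.inl ⟨hd.2.symm, hd.1.symm⟩)
      simp [hadj, hσd, hne, spinVal]
    · by_cases hul : u = l
      · subst hul
        have hadj : (grid n).Adj v u := by
          rw [grid_adj]; exact Or.inr (Or.inr (Or.inl ⟨hl.1.symm, hl.2⟩))
        simp [hadj, hσl, hud, spinVal]
      · rw [if_neg hud, if_neg hul]
        have nn : (0:ℝ) ≤ (if u.1.val + 1 = v.1.val ∧ u.2 = v.2 ∧ σ u = true then (1:ℝ) else 0) := by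
          split_ifs <;> norm_num
        have nn2 : (0:ℝ) ≤ (if u.1 = v.1 ∧ v.2.val + 1 = u.2.val ∧ σ u = true then (1:ℝ) else 0) := by
          split_ifs <;> norm_num
        by_cases hσ : σ u = true
        · by_cases hadj : (grid n).Adj v u
          · rw [if_pos hadj]
            have hs : spinVal (σ u) = 1 := by simp [spinVal, hσ]
            rw [hs]
            rw [grid_adj] at hadj
            rcases hadj with h | h | h | h
            · rw [if_pos (⟨h.1.symm, h.2, hσ⟩ : u.1 = v.1 ∧ v.2.val + 1 = u.2.val ∧ σ u = true)]
              linarith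
            · exact absurd (Prod.ext (Fin.ext (by rw [hd.1, h.2])) (by rw [hd.2, h.1])) hud
            · exact absurd (Prod.ext (by rw [hl.1, h.1]) (Fin.ext (by have := hl.2; omega))) hul
            · rw [if_pos (⟨h.2, h.1.symm, hσ⟩ : u.1.val + 1 = v.1.val ∧ u.2 = v.2 ∧ σ u = true)]
              linarith
          · rw [if_neg hadj]; linarith
        · have hs : spinVal (σ u) = -1 := by simp [spinVal, hσ]
          rw [hs]
          split_ifs <;> linarith
  unfold nbrSum
  refine (Finset.sum_le_sum (fun u _ => hp u)).trans (le_of_eq ?_)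
  rw [Finset.sum_add_distrib, Finset.sum_add_distrib, Finset.sum_add_distrib]
  rw [Finset.sum_ite_eq' univ d, Finset.sum_ite_eq' univ l, Finset.sum_boole, Finset.sum_boole]
  simp only [Finset.mem_univ, if_true]
  ring

lemma nbr_facts (σ : Fin n × Fin n → Bool) (hD : ∀ v ∈ diag n, σ v = false)
    (v : Fin n × Fin n) (hv : v.1 < v.2)
    (h1 : ∀ u ∈ Yu σ, ¬ (v.1.val + 1 = u.1.val ∧ u.2 = v.2))
    (h2 : ∀ u ∈ Yu σ, ¬ (u.1 = v.1 ∧ u.2.val + 1 = v.2.val)) :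
    nbrSum (grid n) σ v ≤ 0 ∧ (v ∉ Yu σ → v ∉ AddS (Yu σ) → nbrSum (grid n) σ v ≤ -1) := by
  have hv' : v.1.val < v.2.val := hv
  have hb := v.2.isLt
  have hz : ∀ u : Fin n × Fin n, u.1.val ≤ u.2.val → u ∉ Yu σ → σ u = false := by
    intro u hu hY
    rcases hu.lt_or_eq with h | h
    · by_contra hc
      exact hY (Yu_self (by simpa using hc) h)
    · exact hD u (by simp [_root_.diag, Fin.ext_iff, h])
  have hB := nbr_bound σ v (⟨v.1.val + 1, by omega⟩, v.2) (v.1, ⟨v.2.val - 1, by omega⟩)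
    ⟨rfl, rfl⟩ ⟨rfl, by simp; omega⟩
    (hz _ (by simp; omega) (fun h => h1 _ h ⟨rfl, rfl⟩))
    (hz _ (by simp; omega) (fun h => h2 _ h ⟨rfl, by simp; omega⟩))
  set A := univ.filter (fun u : Fin n × Fin n => u.1.val + 1 = v.1.val ∧ u.2 = v.2 ∧ σ u = true) with hA
  set B := univ.filter (fun u : Fin n × Fin n => u.1 = v.1 ∧ v.2.val + 1 = u.2.val ∧ σ u = true) with hBd
  have cA : A.card ≤ 1 := by
    rw [Finset.card_le_one]
    intro a ha b hb
    simp only [hA, Finset.mem_filter] at ha hb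
    exact Prod.ext (Fin.ext (by omega)) (ha.2.2.1.trans hb.2.2.1.symm)
  have cB : B.card ≤ 1 := by
    rw [Finset.card_le_one]
    intro a ha b hb
    simp only [hBd, Finset.mem_filter] at ha hb
    exact Prod.ext (ha.2.1.trans hb.2.1.symm) (Fin.ext (by omega))
  have cA' : (A.card : ℝ) ≤ 1 := by exact_mod_cast cA
  have cB' : (B.card : ℝ) ≤ 1 := by exact_mod_cast cB
  refine ⟨by linarith, fun hvY hvA => ?_⟩
  by_cases eA : A = ∅
  · rw [eA] at hB; simp at hB; linarith
  by_cases eB : B = ∅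
  · rw [eB] at hB; simp at hB; linarith
  exfalso
  apply hvA
  obtain ⟨a, ha⟩ := Finset.nonempty_iff_ne_empty.2 eA
  obtain ⟨b, hb⟩ := Finset.nonempty_iff_ne_empty.2 eB
  simp only [hA, hBd, Finset.mem_filter] at ha hb
  simp only [AddS, Finset.mem_filter]
  refine ⟨Finset.mem_univ _, hvY, ⟨a, Yu_self ha.2.2.2 ?_, ha.2.1, ha.2.2.1⟩,
    ⟨b, Yu_self hb.2.2.2 ?_, hb.2.1, hb.2.2.1, hv'⟩⟩
  · rw [ha.2.2.1, Fin.lt_def]; omega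
  · rw [hb.2.1, Fin.lt_def]; omega

lemma Yu_update_not_upper (σ : Fin n × Fin n → Bool) (v : Fin n × Fin n) (b : Bool)
    (hv : ¬ v.1 < v.2) : Yu (Function.update σ v b) = Yu σ := by
  ext w
  rw [mem_Yu, mem_Yu]
  apply exists_congr
  intro x
  by_cases hx : x = v
  · subst hx; simp [hv]
  · rw [Function.update_of_ne hx]

lemma Yu_update_false (σ : Fin n × Fin n → Bool) (v : Fin n × Fin n) :
    Yu (Function.update σ v false) ⊆ Yu σ := by
  intro w hw
  rw [mem_Yu] at *
  obtain ⟨x, a, b⟩ := hw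
  by_cases hx : x = v
  · subst hx; simp at a
  · rw [Function.update_of_ne hx] at a; exact ⟨x, a, b⟩

lemma Yu_update_true_mem (σ : Fin n × Fin n → Bool) (v : Fin n × Fin n) (hv : v ∈ Yu σ) :
    Yu (Function.update σ v true) ⊆ Yu σ := by
  intro w hw
  rw [mem_Yu] at hw
  obtain ⟨x, a, b, c, d⟩ := hw
  by_cases hx : x = v
  · subst hx; exact Yu_up hv c d
  · rw [Function.update_of_ne hx] at a; exact mem_Yu.2 ⟨x, a, b, c, d⟩

lemma Yu_update_true_add (σ : Fin n × Fin n → Bool) (v : Fin n × Fin n)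
    (hv : v ∈ AddS (Yu σ)) :
    Yu (Function.update σ v true) ⊆ insert v (Yu σ) := by
  intro w hw
  rw [Finset.mem_insert]
  rw [mem_Yu] at hw
  simp only [AddS, Finset.mem_filter] at hv
  obtain ⟨_, hvY, ⟨y, hy, hy1, hy2⟩, u, hu, hu1, hu2⟩ := hv
  obtain ⟨x, a, b, c, d⟩ := hw
  by_cases hx : x = v
  · subst hx
    rw [Fin.le_def] at c d
    by_cases e1 : w.1.val = x.1.val
    · by_cases e2 : w.2.val = x.2.val
      · exact Or.inl (Prod.ext (Fin.ext e1) (Fin.ext e2))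
      · refine Or.inr (Yu_up hu ?_ ?_)
        · rw [hu1, Fin.le_def]; omega
        · rw [Fin.le_def]; omega
    · refine Or.inr (Yu_up hy ?_ ?_)
      · rw [Fin.le_def]; omega
      · rw [hy2, Fin.le_def]; omega
  · rw [Function.update_of_ne hx] at a; exact Or.inr (mem_Yu.2 ⟨x, a, b, c, d⟩)

lemma Yu_update_false_rem (σ : Fin n × Fin n → Bool) (v : Fin n × Fin n)
    (hv : v ∈ RemS (Yu σ)) :
    Yu (Function.update σ v false) ⊆ (Yu σ).erase v := by
  intro w hw
  rw [Finset.mem_erase]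
  refine ⟨?_, Yu_update_false σ v hw⟩
  rintro rfl
  simp only [RemS, Finset.mem_filter] at hv
  obtain ⟨_, hwY, h1, h2⟩ := hv
  rw [mem_Yu] at hw
  obtain ⟨x, a, b, c, d⟩ := hw
  by_cases hx : x = w
  · subst hx; simp at a
  rw [Function.update_of_ne hx] at a
  have hxY := Yu_self a b
  rw [Fin.le_def] at c d
  rw [Fin.lt_def] at b
  by_cases e1 : w.1.val = x.1.val
  · by_cases e2 : x.2.val = w.2.val
    · exact hx (Prod.ext (Fin.ext e1.symm) (Fin.ext e2))
    · have hb := w.2.isLt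
      refine h2 (w.1, ⟨w.2.val - 1, by omega⟩) (Yu_up hxY ?_ ?_) ⟨rfl, ?_⟩
      · rw [Fin.le_def]; simp; omega
      · rw [Fin.le_def]; simp; omega
      · simp; omega
  · have hb := x.1.isLt
    refine h1 (⟨w.1.val + 1, by omega⟩, w.2) (Yu_up hxY ?_ ?_) ⟨rfl, rfl⟩
    · rw [Fin.le_def]; simp; omega
    · rw [Fin.le_def]; simp; omega

def gU (σ : Fin n × Fin n → Bool) : ℝ := ((Yu σ).card : ℝ)

lemma gU_nonneg (σ : Fin n × Fin n → Bool) : 0 ≤ gU σ := by unfold gU; positivity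

lemma gU_le (σ : Fin n × Fin n → Bool) : gU σ ≤ (n:ℝ)^2 := by
  unfold gU
  have : (Yu σ).card ≤ n * n := by
    simpa using Finset.card_le_univ (Yu σ)
  have h : ((Yu σ).card : ℝ) ≤ ((n * n : ℕ) : ℝ) := by exact_mod_cast this
  push_cast at h
  nlinarith

lemma step_upper (hn : 2 ≤ n) (β : ℝ) (hβ : 4 * Real.log n ≤ β)
    (σ : Fin n × Fin n → Bool) (hD : ∀ v ∈ diag n, σ v = false) (v : Fin n × Fin n) :
    stepE (grid n) β (diag n) σ gU v ≤ gU σ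
      + (if v ∈ AddS (Yu σ) then (1/2:ℝ) else 0) + (if v ∈ RemS (Yu σ) then (-1/2:ℝ) else 0)
      + 1 / (n:ℝ)^6 := by
  have hn0 : (0:ℝ) < n := by positivity
  have h6 : (0:ℝ) ≤ 1 / (n:ℝ)^6 := by positivity
  have hβ0 : 0 ≤ β := le_trans (mul_nonneg (by norm_num) (Real.log_natCast_nonneg n)) hβ
  have p0 := glauberP_nonneg β (grid n) σ v
  have p1 := glauberP_le_one β (grid n) σ v
  unfold stepE
  by_cases hv : v.1 < v.2
  swap
  · have eA : v ∉ AddS (Yu σ) := by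
      intro h
      simp only [AddS, Finset.mem_filter] at h
      obtain ⟨_, _, ⟨y, hy, hy1, hy2⟩, u, hu, hu1, hu2⟩ := h
      exact hv hu2.2
    have eR : v ∉ RemS (Yu σ) := by
      intro h
      simp only [RemS, Finset.mem_filter] at h
      exact hv (Yu_lt h.2.1)
    have e : ∀ b, gU (Function.update σ v b) = gU σ := by
      intro b; unfold gU; rw [Yu_update_not_upper σ v b hv]
    rw [if_neg eA, if_neg eR, e, e]
    split_ifs
    · linarith
    · linarith
  have hnd : v ∉ diag n := by simp [_root_.diag]; exact hv.ne
  rw [if_neg hnd]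
  have mf : gU (Function.update σ v false) ≤ gU σ := by
    unfold gU; exact_mod_cast Finset.card_le_card (Yu_update_false σ v)
  by_cases hY : v ∈ Yu σ
  · have eA : v ∉ AddS (Yu σ) := by
      intro h; simp only [AddS, Finset.mem_filter] at h; exact h.2.1 hY
    rw [if_neg eA]
    have mt : gU (Function.update σ v true) ≤ gU σ := by
      unfold gU; exact_mod_cast Finset.card_le_card (Yu_update_true_mem σ v hY)
    by_cases hR : v ∈ RemS (Yu σ)
    · rw [if_pos hR]
      have mf' : gU (Function.update σ v false) ≤ gU σ - 1 := by
        have h1 := Finset.card_le_card (Yu_update_false_rem σ v hR)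
        have h2 := Finset.card_erase_add_one hY
        have : (Yu (Function.update σ v false)).card + 1 ≤ (Yu σ).card := by omega
        have h3 : ((Yu (Function.update σ v false)).card : ℝ) + 1 ≤ (Yu σ).card := by
          exact_mod_cast this
        unfold gU; linarith
      simp only [RemS, Finset.mem_filter] at hR
      have hp := glauberP_le_half β hβ0 (grid n) σ v (nbr_facts σ hD v hv hR.2.2.1 hR.2.2.2).1
      nlinarith
    · rw [if_neg hR]
      nlinarith
  · have eR : v ∉ RemS (Yu σ) := by
      intro h; simp only [RemS, Finset.mem_filter] at h; exact hY h.2.1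
    rw [if_neg eR]
    have hf := nbr_facts σ hD v hv
      (fun u hu h => hY (Yu_up hu (by rw [Fin.le_def]; omega) (by rw [h.2])))
      (fun u hu h => hY (Yu_up hu (by rw [h.1]) (by rw [Fin.le_def]; omega)))
    by_cases hA : v ∈ AddS (Yu σ)
    · rw [if_pos hA]
      have hp := glauberP_le_half β hβ0 (grid n) σ v hf.1
      have mt : gU (Function.update σ v true) ≤ gU σ + 1 := by
        have h1 := (Finset.card_le_card (Yu_update_true_add σ v hA)).trans (Finset.card_insert_le _ _)
        unfold gU; exact_mod_cast h1
      nlinarith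
    · rw [if_neg hA]
      have hp := glauberP_le_small β n hn hβ (grid n) σ v (hf.2 hY hA)
      have mt := gU_le (Function.update σ v true)
      have h3 : glauberP β (grid n) σ v * gU (Function.update σ v true) ≤ 1 / (n:ℝ)^8 * (n:ℝ)^2 :=
        mul_le_mul hp mt (gU_nonneg _) (by positivity)
      have h4 : 1 / (n:ℝ)^8 * (n:ℝ)^2 = 1 / (n:ℝ)^6 := by field_simp
      rw [h4] at h3
      have h5 : (1 - glauberP β (grid n) σ v) * gU (Function.update σ v false) ≤ 1 * gU σ :=
        mul_le_mul (by linarith) mf (gU_nonneg _) (by norm_num)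
      linarith

lemma sum_upper (hn : 2 ≤ n) (β : ℝ) (hβ : 4 * Real.log n ≤ β)
    (σ : Fin n × Fin n → Bool) (hD : ∀ v ∈ diag n, σ v = false) :
    ∑ v, stepE (grid n) β (diag n) σ gU v ≤ (n:ℝ)^2 * gU σ + 1/16
      - (if (Yu σ).Nonempty then (1/2:ℝ) else 0) := by
  have hn' : (2:ℝ) ≤ n := by exact_mod_cast hn
  have hn0 : (0:ℝ) < n := by linarith
  refine (Finset.sum_le_sum (fun v _ => step_upper hn β hβ σ hD v)).trans ?_
  rw [Finset.sum_add_distrib, Finset.sum_add_distrib, Finset.sum_add_distrib]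
  rw [Finset.sum_ite_mem, Finset.sum_ite_mem, Finset.univ_inter, Finset.univ_inter]
  simp only [Finset.sum_const, Finset.card_univ, Fintype.card_prod, Fintype.card_fin, nsmul_eq_mul]
  push_cast
  have e : (n:ℝ) * n * (1 / (n:ℝ)^6) ≤ 1/16 := by
    have : (n:ℝ) * n * (1 / (n:ℝ)^6) = 1 / (n:ℝ)^4 := by field_simp
    rw [this]
    apply one_div_le_one_div_of_le (by norm_num)
    calc (16:ℝ) = 2^4 := by norm_num
      _ ≤ (n:ℝ)^4 := by gcongr
  have c : ((AddS (Yu σ)).card : ℝ) + (if (Yu σ).Nonempty then (1:ℝ) else 0) ≤ (RemS (Yu σ)).card := by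
    split_ifs with h
    · exact_mod_cast add_card_lt σ h
    · rw [add_zero]; exact_mod_cast add_card_le σ
  split_ifs at * <;> nlinarith

def swp (σ : Fin n × Fin n → Bool) : Fin n × Fin n → Bool := fun v => σ v.swap

lemma swp_update (σ : Fin n × Fin n → Bool) (v : Fin n × Fin n) (b : Bool) :
    swp (Function.update σ v b) = Function.update (swp σ) v.swap b := by
  funext w
  unfold swp
  by_cases h : w = v.swap
  · subst h; simp
  · have : w.swap ≠ v := by rintro rfl; simp at h
    simp [Function.update_of_ne h, Function.update_of_ne this]

lemma nbrSum_swp (σ : Fin n × Fin n → Bool) (v : Fin n × Fin n) :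
    nbrSum (grid n) (swp σ) v.swap = nbrSum (grid n) σ v := by
  unfold nbrSum
  rw [← (Equiv.prodComm (Fin n) (Fin n)).sum_comp]
  apply Finset.sum_congr rfl
  intro u _
  have : (grid n).Adj v.swap u.swap ↔ (grid n).Adj v u := by
    rw [grid_adj, grid_adj]; simp; tauto
  simp [swp, this]

lemma step_swp (β : ℝ) (σ : Fin n × Fin n → Bool) (v : Fin n × Fin n) :
    stepE (grid n) β (diag n) σ (fun τ => gU (swp τ)) v
      = stepE (grid n) β (diag n) (swp σ) gU v.swap := by
  unfold stepE glauberP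
  have : v.swap ∈ diag n ↔ v ∈ diag n := by simp [_root_.diag, eq_comm]
  simp only [swp_update, nbrSum_swp, this]

def Dn (σ : Fin n × Fin n → Bool) : ℕ := ((diag n).filter (fun v => σ v = true)).card

def lyF (σ : Fin n × Fin n → Bool) : ℝ :=
  if Dn σ = 0 then gU σ + gU (swp σ) else 2 * (n:ℝ)^2 + Dn σ

lemma lyF_nonneg (σ : Fin n × Fin n → Bool) : 0 ≤ lyF σ := by
  unfold lyF
  have := gU_nonneg σ
  have := gU_nonneg (swp σ)
  split_ifs <;> positivity

lemma lyF_le (σ : Fin n × Fin n → Bool) : lyF σ ≤ 2 * (n:ℝ)^2 + Dn σ := by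
  unfold lyF
  have := gU_le σ
  have := gU_le (swp σ)
  have : (0:ℝ) ≤ Dn σ := by positivity
  split_ifs <;> linarith

lemma Dn_le (σ : Fin n × Fin n → Bool) : (Dn σ : ℝ) ≤ (n:ℝ)^2 := by
  have : Dn σ ≤ n * n := by
    unfold Dn
    simpa using Finset.card_le_univ ((diag n).filter (fun v => σ v = true))
  have h : (Dn σ : ℝ) ≤ ((n * n : ℕ) : ℝ) := by exact_mod_cast this
  push_cast at h
  nlinarith

lemma Dn_zero (σ : Fin n × Fin n → Bool) : Dn σ = 0 ↔ ∀ v ∈ diag n, σ v = false := by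
  unfold Dn
  rw [Finset.card_eq_zero, Finset.filter_eq_empty_iff]
  simp

lemma Dn_off (σ : Fin n × Fin n → Bool) (v : Fin n × Fin n) (b : Bool) (hv : v ∉ diag n) :
    Dn (Function.update σ v b) = Dn σ := by
  unfold Dn
  congr 1
  apply Finset.filter_congr
  intro w hw
  have : w ≠ v := by rintro rfl; exact hv hw
  rw [Function.update_of_ne this]

lemma filt_false (σ : Fin n × Fin n → Bool) (v : Fin n × Fin n) :
    (diag n).filter (fun w => Function.update σ v false w = true) =
      ((diag n).filter (fun w => σ w = true)).erase v := by
  ext w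
  by_cases h : w = v
  · subst h; simp
  · simp [h]

lemma Dn_false_le (σ : Fin n × Fin n → Bool) (v : Fin n × Fin n) :
    Dn (Function.update σ v false) ≤ Dn σ := by
  unfold Dn; rw [filt_false]; exact Finset.card_le_card (Finset.erase_subset _ _)

lemma Dn_false_lt (σ : Fin n × Fin n → Bool) (v : Fin n × Fin n) (hv : v ∈ diag n)
    (h : σ v = true) : Dn (Function.update σ v false) + 1 = Dn σ := by
  unfold Dn; rw [filt_false]; exact Finset.card_erase_add_one (by simp [hv, h])

lemma sum_drift (hn : 1 ≤ n) (β : ℝ) (hβ : 4 * Real.log n ≤ β)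
    (σ : Fin n × Fin n → Bool) (hσ : σ ≠ fun _ => false) :
    ∑ v, stepE (grid n) β (diag n) σ lyF v ≤ (n:ℝ)^2 * lyF σ - 1/4 := by
  by_cases hD : Dn σ = 0
  · have hD' := (Dn_zero σ).1 hD
    obtain ⟨w, hw⟩ : ∃ w, σ w = true := by
      by_contra hc
      push Not at hc
      exact hσ (funext fun w => by simpa using hc w)
    have hwd : w.1 ≠ w.2 := by
      intro h
      have := hD' w (by simp [_root_.diag, h])
      rw [hw] at this; cases this
    have hn2 : 2 ≤ n := by
      have := w.1.isLt
      have := w.2.isLt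
      have : w.1.val ≠ w.2.val := fun h => hwd (Fin.ext h)
      omega
    have hDs : ∀ v ∈ diag n, swp σ v = false := by
      intro v hv
      apply hD'
      simp [_root_.diag] at hv ⊢
      exact hv.symm
    have e : ∀ v, stepE (grid n) β (diag n) σ lyF v = stepE (grid n) β (diag n) σ gU v
        + stepE (grid n) β (diag n) (swp σ) gU v.swap := by
      intro v
      rw [← step_swp]
      unfold stepE
      split_ifs with hv
      · have : Dn (Function.update σ v false) = 0 := by have := Dn_false_le σ v; omega
        rw [lyF, if_pos this]
      · rw [lyF, lyF, if_pos (by rw [Dn_off σ v _ hv, hD]), if_pos (by rw [Dn_off σ v _ hv, hD])]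
        ring
    simp_rw [e]
    rw [Finset.sum_add_distrib]
    have e2 : ∑ v : Fin n × Fin n, stepE (grid n) β (diag n) (swp σ) gU v.swap
        = ∑ v : Fin n × Fin n, stepE (grid n) β (diag n) (swp σ) gU v :=
      (Equiv.prodComm (Fin n) (Fin n)).sum_comp (stepE (grid n) β (diag n) (swp σ) gU)
    rw [e2]
    have s1 := sum_upper hn2 β hβ σ hD'
    have s2 := sum_upper hn2 β hβ (swp σ) hDs
    rw [lyF, if_pos hD]
    rcases lt_or_gt_of_ne hwd with h | h
    · rw [if_pos ⟨w, Yu_self hw h⟩] at s1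
      split_ifs at s2 <;> linarith
    · have hne : (Yu (swp σ)).Nonempty :=
        ⟨w.swap, Yu_self (by simpa [swp] using hw) (by simpa using h)⟩
      rw [if_pos hne] at s2
      split_ifs at s1 <;> linarith
  · obtain ⟨w, hwd, hw⟩ : ∃ w ∈ diag n, σ w = true := by
      by_contra hc
      push Not at hc
      exact hD ((Dn_zero σ).2 (fun v hv => by simpa using hc v hv))
    have hs : lyF σ = 2 * (n:ℝ)^2 + Dn σ := by rw [lyF, if_neg hD]
    have hv : ∀ v, stepE (grid n) β (diag n) σ lyF v ≤ lyF σ + (if v = w then (-1:ℝ) else 0) := by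
      intro v
      unfold stepE
      split_ifs with h1 h2 h2
      · subst h2
        have := lyF_le (Function.update σ v false)
        have h3 := Dn_false_lt σ v h1 hw
        have h4 : (Dn (Function.update σ v false) : ℝ) + 1 = Dn σ := by exact_mod_cast h3
        linarith
      · have := lyF_le (Function.update σ v false)
        have h4 : (Dn (Function.update σ v false) : ℝ) ≤ Dn σ := by
          exact_mod_cast Dn_false_le σ v
        linarith
      · exact absurd (h2 ▸ hwd) h1
      · have a : ∀ b, lyF (Function.update σ v b) = lyF σ := by
          intro b
          rw [hs, lyF, Dn_off σ v b h1, if_neg hD]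
        rw [a, a]; linarith
    refine (Finset.sum_le_sum (fun v _ => hv v)).trans ?_
    rw [Finset.sum_add_distrib, Finset.sum_ite_eq' univ w]
    simp only [Finset.sum_const, Finset.card_univ, Fintype.card_prod, Fintype.card_fin,
      nsmul_eq_mul, Finset.mem_univ, if_true]
    push_cast
    nlinarith

end Upper

/-- **Growing temperature, corrupted diagonal.** For `β ≥ 4·log n`, with the diagonal of
the `n × n` grid pinned to `−1`, starting from any configuration that is `+1` off the
diagonal, the corrupted Glauber dynamics reaches the all-`−1` configuration in expected
time `O(n⁵)`: there is a universal constant `C` with `E[inf{t : X̃_t ≡ −1}] ≤ C·n⁵`. -/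
theorem low_temp_diag_flip :
    ∃ C : ℝ, ∀ (n : ℕ) (β : ℝ), 4 * Real.log n ≤ β →
      ∀ σ₀ : Fin n × Fin n → Bool, (∀ v, v ∉ diag n → σ₀ v = true) →
      expHitTime σ₀ (pinnedK (grid n) β (diag n) false) (fun _ => false)
        ≤ C * (n : ℝ) ^ 5 := by
  refine ⟨12, ?_⟩
  intro n β hβ σ₀ _
  rcases Nat.eq_zero_or_pos n with rfl | hn
  · have h : ∀ t, survProb σ₀ (pinnedK (grid 0) β (diag 0) false) (fun _ => false) t = 0 := by
      intro t
      unfold survProb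
      apply Finset.sum_eq_zero
      intro h _
      rw [if_neg]
      intro hc
      exact hc 0 (funext fun v => v.1.elim0)
    unfold expHitTime
    simp [h]
  · have hn' : (1:ℝ) ≤ n := by exact_mod_cast hn
    have hn0 : (0:ℝ) < n := by linarith
    have key := expHit_le σ₀ (pinnedK (grid n) β (diag n) false)
      (fun x y => pinnedK_nonneg _ _ _ _ x y) (fun _ => false) lyF lyF_nonneg
      (1 / (4 * (n:ℝ)^2)) (by positivity) (by
        intro x hx
        rw [pinnedK_sum]
        have hd := sum_drift hn β hβ x hx
        have hc : (Fintype.card (Fin n × Fin n) : ℝ) = (n:ℝ)^2 := by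
          simp; ring
        rw [hc, inv_mul_le_iff₀ (by positivity)]
        refine hd.trans (le_of_eq ?_)
        field_simp)
    refine key.trans ?_
    have h1 := lyF_le σ₀
    have h2 := Dn_le σ₀
    have h3 : lyF σ₀ ≤ 3 * (n:ℝ)^2 := by linarith
    rw [div_div_eq_mul_div, div_one]
    calc lyF σ₀ * (4 * (n:ℝ)^2) ≤ 3 * (n:ℝ)^2 * (4 * (n:ℝ)^2) := by gcongr
      _ = 12 * (n:ℝ)^4 := by ring
      _ ≤ 12 * (n:ℝ)^5 := by gcongr <;> norm_num

end
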